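/- Let f be a piecewise contracting interval map, injective on each contraction piece, with D ⊂ X̃, and let x ∈ X̃. Then Δ_lr(x) ≠ ∅ if and only if ω(x) is a Cantor set (compact, perfect, totally disconnected) K such that closure(O(y)) = K for every y ∈ K ∩ X̃. -/

import Mathlib

open Filter Topology Set

/-- A piecewise contracting interval map on `X = [c 0, c N]` with contraction pieces
`X_i` delimited by the points `c 0 < c 1 < … < c N`, contraction rate `lam ∈ (0,1)`,
and `fe i` the (unique) continuous `lam`-Lipschitz extension of `f` restricted to the
`i`-th piece to its closure `[c (i-1), c i]`. The pieces are
`X_1 = [c 0, c 1)`, `X_i = (c (i-1), c i)` for `1 < i < N`, `X_N = (c (N-1), c N]`. -/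
structure PCIM where
  N : ℕ
  hN : 2 ≤ N
  c : ℕ → ℝ
  lam : ℝ
  f : ℝ → ℝ
  fe : ℕ → ℝ → ℝ
  hc : StrictMonoOn c (Set.Iic N)
  hlam : lam ∈ Set.Ioo (0 : ℝ) 1
  hmap : Set.MapsTo f (Set.Icc (c 0) (c N)) (Set.Icc (c 0) (c N))
  hfe_lip : ∀ i, 1 ≤ i → i ≤ N →
    ∀ x ∈ Set.Icc (c (i - 1)) (c i), ∀ y ∈ Set.Icc (c (i - 1)) (c i),
      |fe i x - fe i y| ≤ lam * |x - y|
  hfe_eq : ∀ i, 1 ≤ i → i ≤ N → ∀ x ∈ Set.Ioo (c (i - 1)) (c i), fe i x = f x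
  hfe_left : fe 1 (c 0) = f (c 0)
  hfe_right : fe N (c N) = f (c N)

namespace PCIM

variable (P : PCIM)

/-- The phase space `X = [c 0, c N]`. -/
def X : Set ℝ := Set.Icc (P.c 0) (P.c P.N)

/-- The `i`-th contraction piece (`1 ≤ i ≤ N`). -/
def piece (i : ℕ) : Set ℝ :=
  Set.Ioo (P.c (i - 1)) (P.c i)
    ∪ (if i = 1 then {P.c 0} else (∅ : Set ℝ))
    ∪ (if i = P.N then {P.c P.N} else (∅ : Set ℝ))

/-- `Δ`, the set of interior boundary points of the pieces. -/
def Δ : Set ℝ := {y | ∃ i, 1 ≤ i ∧ i < P.N ∧ y = P.c i}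

/-- `X̃ = ⋂ n, f⁻ⁿ(X \ Δ)`: points whose whole forward orbit stays in `X` and avoids `Δ`. -/
def Xt : Set ℝ := {x | ∀ n : ℕ, P.f^[n] x ∈ P.X \ P.Δ}

/-- Forward orbit of `x`. -/
def orbit (x : ℝ) : Set ℝ := Set.range fun n : ℕ => P.f^[n] x

/-- The ω-limit set of `x`: limits of subsequences of the forward orbit. -/
def omega (x : ℝ) : Set ℝ :=
  {y | ∃ φ : ℕ → ℕ, StrictMono φ ∧
    Filter.Tendsto (fun n => P.f^[φ n] x) Filter.atTop (nhds y)}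

/-- `d_i^- = f_i (c_i)`, the left lateral limit of `f` at `c i`. -/
def dminus (i : ℕ) : ℝ := P.fe i (P.c i)

/-- `d_i^+ = f_{i+1} (c_i)`, the right lateral limit of `f` at `c i`. -/
def dplus (i : ℕ) : ℝ := P.fe (i + 1) (P.c i)

/-- `D⁻ = {d_1^-, …, d_{N-1}^-}`. -/
def Dminus : Set ℝ := {y | ∃ i, 1 ≤ i ∧ i < P.N ∧ y = P.dminus i}

/-- `D⁺ = {d_1^+, …, d_{N-1}^+}`. -/
def Dplus : Set ℝ := {y | ∃ i, 1 ≤ i ∧ i < P.N ∧ y = P.dplus i}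

/-- `D`, the set of all one-sided limits of `f` at endpoints of the pieces. -/
def D : Set ℝ := P.Dminus ∪ P.Dplus ∪ {P.fe 1 (P.c 0), P.fe P.N (P.c P.N)}

/-- `A` is pseudo-invariant: for every `x ∈ A` at least one one-sided limit of `f`
at `x` (i.e. some `fe i x` with `x` in the closure of the `i`-th piece) belongs to `A`. -/
def PseudoInvariant (A : Set ℝ) : Prop :=
  ∀ x ∈ A, ∃ i, 1 ≤ i ∧ i ≤ P.N ∧ x ∈ Set.Icc (P.c (i - 1)) (P.c i) ∧ P.fe i x ∈ A

/-- `F_i(A) = closure (f (A ∩ X_i))`. -/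
def Fmap (i : ℕ) (A : Set ℝ) : Set ℝ := closure (P.f '' (A ∩ P.piece i))

/-- For a word `w = [i_1, …, i_n]`, the set `F_{i_n} ∘ … ∘ F_{i_1} (X)`. -/
def atomOf (w : List ℕ) : Set ℝ := w.foldl (fun S i => P.Fmap i S) P.X

/-- `A` is an atom of generation `n`. -/
def IsAtomGen (n : ℕ) (A : Set ℝ) : Prop :=
  ∃ w : List ℕ, w.length = n ∧ (∀ i ∈ w, 1 ≤ i ∧ i ≤ P.N) ∧
    A = P.atomOf w ∧ A.Nonempty

/-- `Lam n` is `Λ_{n+1}` of the paper: `Λ_1 = closure (f(X \ Δ))`,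
`Λ_{n+1} = closure (f(Λ_n \ Δ))`. -/
def Lam (P : PCIM) : ℕ → Set ℝ
  | 0 => closure (P.f '' (P.X \ P.Δ))
  | n + 1 => closure (P.f '' (P.Lam n \ P.Δ))

/-- The attractor `Λ = ⋂_{n ≥ 1} Λ_n`. -/
def attractor : Set ℝ := ⋂ n : ℕ, P.Lam n

/-- `c i ∈ Δ_lr(x)`: the boundary point `c i` is left-right recurrently visited by the
orbit of `x`. -/
def lrVisited (x : ℝ) (i : ℕ) : Prop :=
  1 ≤ i ∧ i < P.N ∧
  ∃ l r : ℕ → ℕ, StrictMono l ∧ StrictMono r ∧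
    (∀ j, P.f^[l j] x ∈ P.piece i) ∧ (∀ j, P.f^[r j] x ∈ P.piece (i + 1)) ∧
    Filter.Tendsto (fun j => P.f^[l j] x) Filter.atTop (nhds (P.c i)) ∧
    Filter.Tendsto (fun j => P.f^[r j] x) Filter.atTop (nhds (P.c i))

/-- `c i ∈ Δ_lr`: `c i` is left-right recurrently visited by the orbit of some point
of `X̃`. -/
def inΔlr (i : ℕ) : Prop := ∃ x ∈ P.Xt, P.lrVisited x i

/-- The set `Δ_lr ⊆ Δ`. -/
def ΔlrSet : Set ℝ := {y | ∃ i, P.inΔlr i ∧ y = P.c i}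

/-- The relation `∼⁺` on `Δ_lr`: `c_i ∼⁺ c_j` iff `c_i = c_j` or
(`c_i ∈ Δ_lr(d_j^+)` and `c_j ∈ Δ_lr(d_i^+)`). -/
def simP (a b : ℝ) : Prop :=
  a = b ∨ ∃ i j, P.inΔlr i ∧ P.inΔlr j ∧ a = P.c i ∧ b = P.c j ∧
    P.lrVisited (P.dplus j) i ∧ P.lrVisited (P.dplus i) j

/-- The relation `≼⁺` (on representatives): `[c_i] ≼⁺ [c_j]` iff `[c_i] = [c_j]` or
`c_i ∈ Δ_lr(d_j^+)`. -/
def preP (a b : ℝ) : Prop :=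
  P.simP a b ∨ ∃ i j, P.inΔlr i ∧ P.inΔlr j ∧ a = P.c i ∧ b = P.c j ∧
    P.lrVisited (P.dplus j) i

/-- `[c i]` is a minimal class for the partial order `≼⁺`. -/
def MinimalClass (i : ℕ) : Prop :=
  P.inΔlr i ∧ ∀ j, P.inΔlr j → P.preP (P.c j) (P.c i) → P.simP (P.c j) (P.c i)

/-- `f` is injective on each contraction piece. -/
def InjPieces : Prop := ∀ i, 1 ≤ i → i ≤ P.N → Set.InjOn P.f (P.piece i)

/-- `f` is (strictly) increasing on each contraction piece. -/
def IncrPieces : Prop := ∀ i, 1 ≤ i → i ≤ P.N → StrictMonoOn P.f (P.piece i)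

/-- `x` is a periodic point of `f`. -/
def IsPeriodic (x : ℝ) : Prop := ∃ p : ℕ, 1 ≤ p ∧ P.f^[p] x = x

/-- `η` is the itinerary of `x`: `f^[n] x ∈ X_{η n}` for all `n`. -/
def IsItinerary (x : ℝ) (η : ℕ → ℕ) : Prop :=
  ∀ n, 1 ≤ η n ∧ η n ≤ P.N ∧ P.f^[n] x ∈ P.piece (η n)

end PCIM

/-- The word of length `n` of the sequence `η` starting at position `t`. -/
def wordAt (η : ℕ → ℕ) (t n : ℕ) : List ℕ := (List.range n).map fun m => η (t + m)

/-- The complexity function of the sequence `η`: the number of distinct words of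
length `n` occurring in `η`. -/
noncomputable def complexity (η : ℕ → ℕ) (n : ℕ) : ℕ := Set.ncard {w : List ℕ | ∃ t, w = wordAt η t n}

namespace PCIM

section Basic

variable (P : PCIM)

theorem c_lt {i j : ℕ} (hij : i < j) (hj : j ≤ P.N) : P.c i < P.c j :=
  P.hc (Set.mem_Iic.2 (hij.le.trans hj)) (Set.mem_Iic.2 hj) hij

theorem c_le {i j : ℕ} (hij : i ≤ j) (hj : j ≤ P.N) : P.c i ≤ P.c j :=
  P.hc.monotoneOn (Set.mem_Iic.2 (hij.trans hj)) (Set.mem_Iic.2 hj) hij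

theorem exists_mem_Icc {p : ℝ} (hp : p ∈ P.X) :
    ∃ i, 1 ≤ i ∧ i ≤ P.N ∧ p ∈ Icc (P.c (i - 1)) (P.c i) := by
  classical
  have hN := P.hN
  have hex : ∃ i, p ≤ P.c (i + 1) := ⟨P.N - 1, by
    have : P.N - 1 + 1 = P.N := by omega
    rw [this]; exact hp.2⟩
  refine ⟨Nat.find hex + 1, by omega, ?_, ?_, Nat.find_spec hex⟩
  · have : Nat.find hex ≤ P.N - 1 := Nat.find_min' hex (by
      have : P.N - 1 + 1 = P.N := by omega
      rw [this]; exact hp.2)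
    omega
  · rcases Nat.eq_zero_or_pos (Nat.find hex) with h | h
    · rw [h]; exact hp.1
    · have := Nat.find_min hex (m := Nat.find hex - 1) (by omega)
      have e : Nat.find hex - 1 + 1 = Nat.find hex := by omega
      rw [e, not_le] at this
      simpa using this.le

theorem fe_eq_f {i : ℕ} (h1 : 1 ≤ i) (hi : i ≤ P.N) {p : ℝ}
    (hp : p ∈ Icc (P.c (i - 1)) (P.c i)) (hΔ : p ∉ P.Δ) : P.fe i p = P.f p := by
  rcases hp.1.eq_or_lt with h | h
  · rcases h1.eq_or_lt with h' | h'
    · subst h'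
      simp only [Nat.sub_self] at h
      rw [← h]; exact P.hfe_left
    · exact absurd ⟨i - 1, by omega, by omega, h.symm⟩ hΔ
  rcases hp.2.eq_or_lt with h' | h'
  · rcases hi.eq_or_lt with e | e
    · rw [h', e]; exact P.hfe_right
    · exact absurd ⟨i, h1, e, h'⟩ hΔ
  · exact P.hfe_eq i h1 hi p ⟨h, h'⟩

theorem Ioo_subset_piece (i : ℕ) : Ioo (P.c (i - 1)) (P.c i) ⊆ P.piece i :=
  fun _ h => Or.inl (Or.inl h)

theorem notMem_Δ_of_mem_Ioo {i : ℕ} (h1 : 1 ≤ i) (hi : i ≤ P.N) {p : ℝ}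
    (hp : p ∈ Ioo (P.c (i - 1)) (P.c i)) : p ∉ P.Δ := by
  rintro ⟨j, hj1, hjN, rfl⟩
  rcases le_or_gt i j with h | h
  · exact absurd hp.2 (not_lt.2 (P.c_le h hjN.le))
  · exact absurd hp.1 (not_lt.2 (P.c_le (by omega) (by omega)))

theorem c_mem_Δ {i : ℕ} (h1 : 1 ≤ i) (hi : i < P.N) : P.c i ∈ P.Δ := ⟨i, h1, hi, rfl⟩

theorem finite_Δ : P.Δ.Finite :=
  ((finite_Iic P.N).image P.c).subset (by
    rintro _ ⟨i, _, hi, rfl⟩; exact ⟨i, hi.le, rfl⟩)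

theorem lipschitzOnWith_fe {i : ℕ} (h1 : 1 ≤ i) (hi : i ≤ P.N) :
    LipschitzOnWith (Real.toNNReal P.lam) (P.fe i) (Icc (P.c (i - 1)) (P.c i)) :=
  LipschitzOnWith.of_dist_le_mul fun x hx y hy => by
    rw [Real.coe_toNNReal _ P.hlam.1.le]
    exact P.hfe_lip i h1 hi x hx y hy

/-- The image under a branch of an end point of its closed piece lies in `D`. -/
theorem fe_mem_D {i : ℕ} (h1 : 1 ≤ i) (hi : i ≤ P.N) {w : ℝ}
    (hw : w ∈ Icc (P.c (i - 1)) (P.c i)) (hw' : w ∉ Ioo (P.c (i - 1)) (P.c i)) :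
    P.fe i w ∈ P.D := by
  rcases hw.1.eq_or_lt with h | h
  · rcases h1.eq_or_lt with e | e
    · subst e
      right; left
      simp only [Nat.sub_self] at h
      rw [h]
    · left; right
      refine ⟨i - 1, by omega, by omega, ?_⟩
      have : i - 1 + 1 = i := by omega
      rw [dplus, this, h]
  · rcases hw.2.eq_or_lt with h' | h'
    · rcases hi.eq_or_lt with e | e
      · right; right
        rw [mem_singleton_iff, h', e]
      · left; left
        exact ⟨i, h1, e, by rw [dminus, h']⟩
    · exact absurd ⟨h, h'⟩ hw'

theorem finite_D : P.D.Finite := by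
  refine Finite.union (Finite.union ?_ ?_) (by simp)
  · exact ((finite_Iic P.N).image P.dminus).subset (by
      rintro _ ⟨i, _, hi, rfl⟩; exact ⟨i, hi.le, rfl⟩)
  · exact ((finite_Iic P.N).image P.dplus).subset (by
      rintro _ ⟨i, _, hi, rfl⟩; exact ⟨i, hi.le, rfl⟩)

theorem iterate_mem_Xt {x : ℝ} (hx : x ∈ P.Xt) (k : ℕ) : P.f^[k] x ∈ P.Xt := fun n => by
  rw [← Function.iterate_add_apply]; exact hx _

theorem mem_omega_iff {x z : ℝ} :
    z ∈ P.omega x ↔ ∀ ε > 0, ∀ m : ℕ, ∃ n ≥ m, |P.f^[n] x - z| < ε := by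
  constructor
  · rintro ⟨φ, hφ, hlim⟩ ε hε m
    obtain ⟨k, hk⟩ := (Metric.tendsto_atTop.1 hlim) ε hε
    exact ⟨φ (max k m), (le_max_right k m).trans (hφ.id_le _), hk _ (le_max_left _ _)⟩
  · intro h
    obtain ⟨φ, hφ, hlim⟩ := extraction_forall_of_frequently
      (P := fun k n => |P.f^[n] x - z| < 1 / ((k : ℝ) + 1)) (fun k => by
        rw [frequently_atTop]
        intro m
        exact h _ (by positivity) m)
    refine ⟨φ, hφ, ?_⟩
    rw [tendsto_iff_dist_tendsto_zero]
    exact squeeze_zero (fun _ => dist_nonneg) (fun n => (hlim n).le)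
      tendsto_one_div_add_atTop_nhds_zero_nat

theorem isClosed_omega (x : ℝ) : IsClosed (P.omega x) := by
  refine isClosed_of_closure_subset fun z hz => P.mem_omega_iff.2 fun ε hε m => ?_
  obtain ⟨w, hw, hzw⟩ := Metric.mem_closure_iff.1 hz (ε / 2) (half_pos hε)
  obtain ⟨n, hn, hnw⟩ := P.mem_omega_iff.1 hw (ε / 2) (half_pos hε) m
  refine ⟨n, hn, ?_⟩
  rw [← Real.dist_eq] at hnw ⊢
  rw [dist_comm] at hzw
  linarith [dist_triangle (P.f^[n] x) w z]

theorem omega_subset_X {x : ℝ} (hx : x ∈ P.Xt) : P.omega x ⊆ P.X := by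
  rintro z ⟨φ, -, hlim⟩
  exact isClosed_Icc.mem_of_tendsto hlim (Eventually.of_forall fun n => (hx _).1)

theorem isCompact_omega {x : ℝ} (hx : x ∈ P.Xt) : IsCompact (P.omega x) :=
  isCompact_Icc.of_isClosed_subset (P.isClosed_omega x) (P.omega_subset_X hx)

theorem omega_nonempty {x : ℝ} (hx : x ∈ P.Xt) : (P.omega x).Nonempty := by
  obtain ⟨a, -, φ, hφ, h⟩ :=
    (isCompact_Icc (a := P.c 0) (b := P.c P.N)).tendsto_subseq (fun n => (hx n).1)
  exact ⟨a, φ, hφ, h⟩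

theorem omega_subset_closure_orbit (x : ℝ) : P.omega x ⊆ closure (P.orbit x) := by
  rintro z ⟨φ, -, hlim⟩
  exact mem_closure_of_tendsto hlim (Eventually.of_forall fun n => ⟨_, rfl⟩)

/-- Every point of `ω(x)` is a branch image of a point of `ω(x)`. -/
theorem exists_fe_eq {x : ℝ} (hx : x ∈ P.Xt) {z : ℝ} (hz : z ∈ P.omega x) :
    ∃ i, 1 ≤ i ∧ i ≤ P.N ∧ ∃ w ∈ P.omega x, w ∈ Icc (P.c (i - 1)) (P.c i) ∧ P.fe i w = z := by
  by_contra! H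
  obtain ⟨φ, hφ, hlim⟩ := hz
  choose! η h1 hN hmem using fun n => P.exists_mem_Icc (hx n).1
  obtain ⟨a, ha, ψ, hψ, hψlim⟩ :=
    (isCompact_Icc (a := P.c 0) (b := P.c P.N)).tendsto_subseq (fun n => (hx (φ (n + 1) - 1)).1)
  have hex : ∃ i ∈ Iic P.N, ∃ᶠ n in atTop, η (φ (ψ n + 1) - 1) = i := by
    by_contra! h
    have : ∀ i ∈ Iic P.N, ∀ᶠ n in atTop, η (φ (ψ n + 1) - 1) ≠ i := h
    obtain ⟨n, hn⟩ := ((eventually_all_finite (finite_Iic P.N)).2 this).exists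
    exact hn _ (hN _) rfl
  obtain ⟨i, -, hi⟩ := hex
  obtain ⟨θ, hθ, hθi⟩ := extraction_of_frequently_atTop hi
  have hi1 : 1 ≤ i := by rw [← hθi 0]; exact h1 _
  have hiN : i ≤ P.N := by rw [← hθi 0]; exact hN _
  have hpos : ∀ n, 1 ≤ φ (n + 1) := fun n => by
    have := hφ.id_le (n + 1); simp only [id] at this; omega
  have hin : ∀ n, P.f^[φ (ψ (θ n) + 1) - 1] x ∈ Icc (P.c (i - 1)) (P.c i) := fun n => by
    have := hmem (φ (ψ (θ n) + 1) - 1)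
    rwa [hθi n] at this
  have hlima : Tendsto (fun n => P.f^[φ (ψ (θ n) + 1) - 1] x) atTop (𝓝 a) :=
    hψlim.comp hθ.tendsto_atTop
  have haI : a ∈ Icc (P.c (i - 1)) (P.c i) :=
    isClosed_Icc.mem_of_tendsto hlima (Eventually.of_forall hin)
  refine H i hi1 hiN a ⟨_, ?_, hlima⟩ haI ?_
  · intro m n hmn
    have h1 : φ (ψ (θ m) + 1) < φ (ψ (θ n) + 1) := hφ (by have := hψ (hθ hmn); omega)
    have := hpos (ψ (θ m))
    show φ (ψ (θ m) + 1) - 1 < φ (ψ (θ n) + 1) - 1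
    omega
  · have hfe : Tendsto (fun n => P.fe i (P.f^[φ (ψ (θ n) + 1) - 1] x)) atTop (𝓝 (P.fe i a)) :=
      ((P.lipschitzOnWith_fe hi1 hiN).continuousOn a haI).tendsto.comp
        (tendsto_nhdsWithin_iff.2 ⟨hlima, Eventually.of_forall hin⟩)
    refine tendsto_nhds_unique hfe ?_
    have e : (fun n => P.fe i (P.f^[φ (ψ (θ n) + 1) - 1] x)) =
        fun n => P.f^[φ (ψ (θ n) + 1)] x := by
      funext n
      rw [P.fe_eq_f hi1 hiN (hin n) (hx _).2, ← Function.iterate_succ_apply' P.f]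
      congr 2
      have := hpos (ψ (θ n)); omega
    rw [e]
    have ht : Tendsto (fun n => ψ (θ n) + 1) atTop atTop :=
      (tendsto_add_atTop_nat 1).comp (hψ.tendsto_atTop.comp hθ.tendsto_atTop)
    exact hlim.comp ht

/-- Points of `ω(x)` outside `D` have a preimage in `ω(x)` interior to a piece. -/
theorem exists_preimage {x : ℝ} (hx : x ∈ P.Xt) {z : ℝ} (hz : z ∈ P.omega x) (hzD : z ∉ P.D) :
    ∃ i, 1 ≤ i ∧ i ≤ P.N ∧ ∃ w ∈ P.omega x, w ∈ Ioo (P.c (i - 1)) (P.c i) ∧ P.f w = z := by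
  obtain ⟨i, h1, hi, w, hw, hwI, rfl⟩ := P.exists_fe_eq hx hz
  have : w ∈ Ioo (P.c (i - 1)) (P.c i) := by
    by_contra h
    exact hzD (P.fe_mem_D h1 hi hwI h)
  exact ⟨i, h1, hi, w, hw, this, (P.hfe_eq i h1 hi w this).symm⟩

/-- `ω(x)` is forward invariant off `Δ`. -/
theorem map_mem_omega {x : ℝ} (hx : x ∈ P.Xt) {z : ℝ} (hz : z ∈ P.omega x) (hzΔ : z ∉ P.Δ) :
    P.f z ∈ P.omega x := by
  obtain ⟨δ, hδ, hball⟩ := Metric.isOpen_iff.1 P.finite_Δ.isClosed.isOpen_compl z hzΔ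
  refine P.mem_omega_iff.2 fun ε hε m => ?_
  obtain ⟨n, hn, hnz⟩ := P.mem_omega_iff.1 hz (min δ ε) (lt_min hδ hε) m
  refine ⟨n + 1, by omega, ?_⟩
  obtain ⟨i, h1, hi, hmem⟩ := P.exists_mem_Icc (hx n).1
  have hzX := P.omega_subset_X hx hz
  have habs := abs_lt.1 (hnz.trans_le (min_le_left _ _))
  have hb : ∀ w, |w - z| < δ → w ∉ P.Δ := fun w hw => hball (by simpa [Real.dist_eq] using hw)
  have hzI : z ∈ Icc (P.c (i - 1)) (P.c i) := by
    constructor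
    · by_contra! h
      rcases h1.eq_or_lt with e | e
      · subst e; exact absurd hzX.1 (not_le.2 h)
      · exact hb (P.c (i - 1)) (abs_lt.2 ⟨by linarith, by linarith [hmem.1]⟩)
          (P.c_mem_Δ (by omega) (by omega))
    · by_contra! h
      rcases hi.eq_or_lt with e | e
      · subst e; exact absurd hzX.2 (not_le.2 h)
      · exact hb (P.c i) (abs_lt.2 ⟨by linarith [hmem.2], by linarith⟩)
          (P.c_mem_Δ (by omega) (by omega))
  rw [Function.iterate_succ_apply', ← P.fe_eq_f h1 hi hmem (hx n).2, ← P.fe_eq_f h1 hi hzI hzΔ]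
  have h2 := P.hfe_lip i h1 hi _ hmem _ hzI
  have h3 := hnz.trans_le (min_le_right _ _)
  have h4 := P.hlam.2
  nlinarith [abs_nonneg (P.f^[n] x - z)]

theorem iterate_mem_omega {x : ℝ} (hx : x ∈ P.Xt) {y : ℝ} (hy : y ∈ P.omega x) (hyt : y ∈ P.Xt)
    (n : ℕ) : P.f^[n] y ∈ P.omega x := by
  induction n with
  | zero => exact hy
  | succ n ih =>
    rw [Function.iterate_succ_apply']
    exact P.map_mem_omega hx ih (hyt n).2

theorem orbit_subset_omega {x : ℝ} (hx : x ∈ P.Xt) {y : ℝ} (hy : y ∈ P.omega x)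
    (hyt : y ∈ P.Xt) : P.orbit y ⊆ P.omega x := by
  rintro _ ⟨n, rfl⟩
  exact P.iterate_mem_omega hx hy hyt n

end Basic

end PCIM

namespace PCIM

/-- One of the two one-sided neighbourhoods of `z` of radius `r` misses `K`. -/
def SideGap (K : Set ℝ) (z r : ℝ) : Prop :=
  (∀ v ∈ K, z < v → z + r ≤ v) ∨ (∀ v ∈ K, v < z → v ≤ z - r)

section Gaps

variable (P : PCIM)

/-- Points of `K` not separated by `K` from some `c i`. -/
def extremePoints (K : Set ℝ) : Set ℝ :=
  ⋃ i ∈ Iic P.N, ({z ∈ K | z < P.c i ∧ ∀ v ∈ K, z < v → P.c i ≤ v} ∪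
    {z ∈ K | P.c i < z ∧ ∀ v ∈ K, v < z → v ≤ P.c i})

theorem finite_extremePoints (K : Set ℝ) : (P.extremePoints K).Finite := by
  refine (finite_Iic P.N).biUnion fun i _ => Finite.union ?_ ?_
  · refine Subsingleton.finite fun z hz w hw => ?_
    by_contra h
    rcases lt_or_gt_of_ne h with h | h
    · exact absurd (hz.2.2 w hw.1 h) (not_le.2 hw.2.1)
    · exact absurd (hw.2.2 z hz.1 h) (not_le.2 hz.2.1)
  · refine Subsingleton.finite fun z hz w hw => ?_
    by_contra h
    rcases lt_or_gt_of_ne h with h | h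
    · exact absurd (hw.2.2 z hz.1 h) (not_le.2 hz.2.1)
    · exact absurd (hz.2.2 w hw.1 h) (not_le.2 hw.2.1)

variable {P}

theorem strictMonoOn_or_strictAntiOn (hinj : P.InjPieces) {i : ℕ} (h1 : 1 ≤ i) (hi : i ≤ P.N) :
    StrictMonoOn P.f (Ioo (P.c (i - 1)) (P.c i)) ∨
      StrictAntiOn P.f (Ioo (P.c (i - 1)) (P.c i)) := by
  refine ContinuousOn.strictMonoOn_of_injOn_Ioo (P.c_lt (by omega) hi) ?_
    ((hinj i h1 hi).mono (P.Ioo_subset_piece i))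
  exact ((P.lipschitzOnWith_fe h1 hi).continuousOn.mono Ioo_subset_Icc_self).congr
    fun v hv => (P.hfe_eq i h1 hi v hv).symm

/-- A one-sided gap pulls back to an expanded gap, unless the latter reaches the boundary of the
piece. -/
theorem SideGap.preimage (hinj : P.InjPieces) {x : ℝ} (hx : x ∈ P.Xt) {i : ℕ} (h1 : 1 ≤ i)
    (hi : i ≤ P.N) {w r : ℝ} (hw : w ∈ P.omega x) (hwI : w ∈ Ioo (P.c (i - 1)) (P.c i))
    (hr : 0 < r) (hgap : SideGap (P.omega x) (P.f w) r) :
    (w ∈ P.extremePoints (P.omega x) ∨ SideGap (P.omega x) w (r / P.lam)) ∧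
      ∃ η > 0, SideGap (P.omega x) w η := by
  have hl := P.hlam.1
  have key : ∀ v ∈ P.omega x, v ∈ Ioo (P.c (i - 1)) (P.c i) → |v - w| < r / P.lam →
      P.f v ∈ P.omega x ∧ |P.f v - P.f w| < r := fun v hv hvI hvw => by
    refine ⟨P.map_mem_omega hx hv (P.notMem_Δ_of_mem_Ioo h1 hi hvI), ?_⟩
    rw [← P.hfe_eq i h1 hi v hvI, ← P.hfe_eq i h1 hi w hwI]
    refine (P.hfe_lip i h1 hi v (Ioo_subset_Icc_self hvI) w (Ioo_subset_Icc_self hwI)).trans_lt ?_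
    rwa [lt_div_iff₀' hl] at hvw
  have core : (∀ v ∈ P.omega x, w < v → v < P.c i → w + r / P.lam ≤ v) ∨
      (∀ v ∈ P.omega x, v < w → P.c (i - 1) < v → v ≤ w - r / P.lam) := by
    rcases strictMonoOn_or_strictAntiOn hinj h1 hi with hm | hm <;> rcases hgap with hg | hg
    · left
      intro v hv hwv hvc
      by_contra! h
      have hvI : v ∈ Ioo (P.c (i - 1)) (P.c i) := ⟨hwI.1.trans hwv, hvc⟩
      obtain ⟨hfv, hlt⟩ := key v hv hvI (abs_lt.2 ⟨by linarith [div_pos hr hl], by linarith⟩)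
      linarith [hg _ hfv (hm hwI hvI hwv), (abs_lt.1 hlt).2]
    · right
      intro v hv hwv hvc
      by_contra! h
      have hvI : v ∈ Ioo (P.c (i - 1)) (P.c i) := ⟨hvc, hwv.trans hwI.2⟩
      obtain ⟨hfv, hlt⟩ := key v hv hvI (abs_lt.2 ⟨by linarith, by linarith [div_pos hr hl]⟩)
      linarith [hg _ hfv (hm hvI hwI hwv), (abs_lt.1 hlt).1]
    · right
      intro v hv hwv hvc
      by_contra! h
      have hvI : v ∈ Ioo (P.c (i - 1)) (P.c i) := ⟨hvc, hwv.trans hwI.2⟩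
      obtain ⟨hfv, hlt⟩ := key v hv hvI (abs_lt.2 ⟨by linarith, by linarith [div_pos hr hl]⟩)
      linarith [hg _ hfv (hm hvI hwI hwv), (abs_lt.1 hlt).2]
    · left
      intro v hv hwv hvc
      by_contra! h
      have hvI : v ∈ Ioo (P.c (i - 1)) (P.c i) := ⟨hwI.1.trans hwv, hvc⟩
      obtain ⟨hfv, hlt⟩ := key v hv hvI (abs_lt.2 ⟨by linarith [div_pos hr hl], by linarith⟩)
      linarith [hg _ hfv (hm hwI hvI hwv), (abs_lt.1 hlt).1]
  rcases core with H | H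
  · constructor
    · rcases le_or_gt (P.c i) (w + r / P.lam) with h | h
      · left
        refine mem_biUnion (mem_Iic.2 hi) (Or.inl ⟨hw, hwI.2, fun v hv hwv => ?_⟩)
        by_contra! hlt
        linarith [H v hv hwv hlt]
      · right; left
        intro v hv hwv
        rcases lt_or_ge v (P.c i) with h' | h'
        · exact H v hv hwv h'
        · linarith
    · refine ⟨min (r / P.lam) (P.c i - w), lt_min (div_pos hr hl) (sub_pos.2 hwI.2), Or.inl ?_⟩
      intro v hv hwv
      rcases lt_or_ge v (P.c i) with h' | h'
      · linarith [H v hv hwv h', min_le_left (r / P.lam) (P.c i - w)]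
      · linarith [min_le_right (r / P.lam) (P.c i - w)]
  · constructor
    · rcases le_or_gt (w - r / P.lam) (P.c (i - 1)) with h | h
      · left
        refine mem_biUnion (mem_Iic.2 (show i - 1 ≤ P.N by omega))
          (Or.inr ⟨hw, hwI.1, fun v hv hwv => ?_⟩)
        by_contra! hlt
        linarith [H v hv hwv hlt]
      · right; right
        intro v hv hwv
        rcases lt_or_ge (P.c (i - 1)) v with h' | h'
        · exact H v hv hwv h'
        · linarith
    · refine ⟨min (r / P.lam) (w - P.c (i - 1)), lt_min (div_pos hr hl) (sub_pos.2 hwI.1),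
        Or.inr ?_⟩
      intro v hv hwv
      rcases lt_or_ge (P.c (i - 1)) v with h' | h'
      · linarith [H v hv hwv h', min_le_left (r / P.lam) (w - P.c (i - 1))]
      · linarith [min_le_right (r / P.lam) (w - P.c (i - 1))]

/-- A point of `Δ ∩ ω(x)` is accumulated by `ω(x)` from both sides. -/
theorem not_sideGap (hinj : P.InjPieces) (hD : P.D ⊆ P.Xt) {x : ℝ} (hx : x ∈ P.Xt) {z : ℝ}
    (hz : z ∈ P.omega x) (hzΔ : z ∈ P.Δ) {r : ℝ} (hr : 0 < r) :
    ¬ SideGap (P.omega x) z r := by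
  intro hgap
  set K := P.omega x with hK
  let S := {w : ℝ // w ∈ K ∧ ∃ n, P.f^[n] w ∈ P.Δ}
  have hpre : ∀ s : S, ∃ t : S, P.f t.1 = s.1 ∧
      ∃ i, 1 ≤ i ∧ i ≤ P.N ∧ t.1 ∈ Ioo (P.c (i - 1)) (P.c i) := by
    rintro ⟨s, hs, n, hn⟩
    obtain ⟨i, h1, hi, w, hw, hwI, rfl⟩ :=
      P.exists_preimage hx hs (fun h => (hD h n).2 hn)
    exact ⟨⟨w, hw, n + 1, by rwa [Function.iterate_succ_apply]⟩, rfl, i, h1, hi, hwI⟩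
  choose g hgf hgI using hpre
  let s : ℕ → S := fun n => g^[n] ⟨z, hz, 0, hzΔ⟩
  have hs : ∀ n, s (n + 1) = g (s n) := fun n => Function.iterate_succ_apply' g n _
  have hsf : ∀ n, P.f (s (n + 1)).1 = (s n).1 := fun n => by rw [hs, hgf]
  have hsI : ∀ n, ∃ i, 1 ≤ i ∧ i ≤ P.N ∧ (s (n + 1)).1 ∈ Ioo (P.c (i - 1)) (P.c i) := fun n => by
    rw [hs]; exact hgI _
  have hhit : ∀ n, P.f^[n] (s n).1 = z := by
    intro n
    induction n with
    | zero => rfl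
    | succ n ih => rw [Function.iterate_succ_apply, hsf, ih]
  have hfirst : ∀ n k, k < n → P.f^[k] (s n).1 ∉ P.Δ := by
    intro n
    induction n with
    | zero => intro k hk; omega
    | succ n ih =>
      rintro (_ | k) hk
      · obtain ⟨i, h1, hi, h⟩ := hsI n
        exact P.notMem_Δ_of_mem_Ioo h1 hi h
      · rw [Function.iterate_succ_apply, hsf]
        exact ih k (by omega)
  have hne : ∀ m n, m < n → (s m).1 ≠ (s n).1 := fun m n hmn h =>
    hfirst n m hmn (by rw [← h, hhit]; exact hzΔ)
  have hsinj : Function.Injective fun n => (s n).1 := by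
    intro m n h
    by_contra hmn
    rcases lt_or_gt_of_ne hmn with h' | h'
    · exact hne _ _ h' h
    · exact hne _ _ h' h.symm
  have hev : ∀ᶠ n in atTop, (s n).1 ∉ P.extremePoints K := by
    rw [← Nat.cofinite_eq_atTop]
    exact hsinj.tendsto_cofinite.eventually (P.finite_extremePoints K).compl_mem_cofinite
  have hstep : ∀ n, ∀ r > 0, SideGap K (s n).1 r →
      ((s (n + 1)).1 ∈ P.extremePoints K ∨ SideGap K (s (n + 1)).1 (r / P.lam)) ∧
        ∃ η > 0, SideGap K (s (n + 1)).1 η := by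
    intro n r hr hg
    obtain ⟨i, h1, hi, hI⟩ := hsI n
    exact SideGap.preimage hinj hx h1 hi (s (n + 1)).2.1 hI hr (by rwa [hsf])
  have hgaps : ∀ n, ∃ η > 0, SideGap K (s n).1 η := by
    intro n
    induction n with
    | zero => exact ⟨r, hr, hgap⟩
    | succ n ih =>
      obtain ⟨η, hη, hg⟩ := ih
      exact (hstep n η hη hg).2
  obtain ⟨n₀, hn₀⟩ := eventually_atTop.1 hev
  obtain ⟨η, hη, hg⟩ := hgaps n₀
  have hl := P.hlam.1
  have hgrow : ∀ k, SideGap K (s (n₀ + k)).1 (η / P.lam ^ k) := by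
    intro k
    induction k with
    | zero => simpa using hg
    | succ k ih =>
      rcases (hstep (n₀ + k) _ (by positivity) ih).1 with h | h
      · exact absurd h (hn₀ _ (by omega))
      · rwa [pow_succ, ← div_div]
  obtain ⟨k, hk⟩ := exists_pow_lt_of_lt_one
    (div_pos hη (sub_pos.2 (P.c_lt (show 0 < P.N by have := P.hN; omega) le_rfl))) P.hlam.2
  have hbig : P.c P.N - P.c 0 < η / P.lam ^ (k + 1) := by
    rw [lt_div_iff₀ (sub_pos.2 (P.c_lt (show 0 < P.N by have := P.hN; omega) le_rfl))] at hk
    rw [lt_div_iff₀ (by positivity), pow_succ]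
    have := P.hlam.2
    have := mul_pos (pow_pos hl k) (sub_pos.2 (P.c_lt (show 0 < P.N by have := P.hN; omega) le_rfl))
    nlinarith
  have hKX := P.omega_subset_X hx
  have hmemK := (s (n₀ + (k + 1))).2.1
  have hX := hKX hmemK
  obtain ⟨i, h1, hi, hI⟩ := hsI (n₀ + k)
  refine hn₀ (n₀ + (k + 1)) (by omega) ?_
  rcases hgrow (k + 1) with h | h
  · refine mem_biUnion (mem_Iic.2 le_rfl) (Or.inl ⟨hmemK, ?_, fun v hv hlt => ?_⟩)
    · exact hI.2.trans_le (P.c_le hi le_rfl)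
    · linarith [h v hv hlt, hX.1]
  · refine mem_biUnion (mem_Iic.2 (Nat.zero_le _)) (Or.inr ⟨hmemK, ?_, fun v hv hlt => ?_⟩)
    · exact (P.c_le (Nat.zero_le _) (by omega)).trans_lt hI.1
    · linarith [h v hv hlt, hX.2]

/-- `ω(x)` is invariant under all branches. -/
theorem fe_mem_omega (hinj : P.InjPieces) (hD : P.D ⊆ P.Xt) {x : ℝ} (hx : x ∈ P.Xt) {i : ℕ}
    (h1 : 1 ≤ i) (hi : i ≤ P.N) {q : ℝ} (hq : q ∈ P.omega x)
    (hqI : q ∈ Icc (P.c (i - 1)) (P.c i)) : P.fe i q ∈ P.omega x := by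
  by_cases hΔ : q ∉ P.Δ
  · rw [P.fe_eq_f h1 hi hqI hΔ]
    exact P.map_mem_omega hx hq hΔ
  rw [not_not] at hΔ
  have hlt : P.c (i - 1) < P.c i := P.c_lt (by omega) hi
  have hnear : q ∈ closure (P.omega x ∩ Ioo (P.c (i - 1)) (P.c i)) := by
    rw [Metric.mem_closure_iff]
    intro ε hε
    rcases hqI.1.eq_or_lt with h | h
    · have hng := not_sideGap hinj hD hx hq hΔ (r := min ε (P.c i - P.c (i - 1)))
        (lt_min hε (sub_pos.2 hlt))
      rw [SideGap, not_or] at hng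
      obtain ⟨hng, -⟩ := hng
      push Not at hng
      obtain ⟨v, hv, hqv, hvq⟩ := hng
      refine ⟨v, ⟨hv, by linarith, ?_⟩, ?_⟩
      · linarith [min_le_right ε (P.c i - P.c (i - 1))]
      · rw [Real.dist_eq, abs_lt]
        constructor <;> linarith [min_le_left ε (P.c i - P.c (i - 1))]
    · have hng := not_sideGap hinj hD hx hq hΔ (r := min ε (q - P.c (i - 1)))
        (lt_min hε (sub_pos.2 h))
      rw [SideGap, not_or] at hng
      obtain ⟨-, hng⟩ := hng
      push Not at hng
      obtain ⟨v, hv, hqv, hvq⟩ := hng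
      refine ⟨v, ⟨hv, ?_, by linarith [hqI.2]⟩, ?_⟩
      · linarith [min_le_right ε (q - P.c (i - 1))]
      · rw [Real.dist_eq, abs_lt]
        constructor <;> linarith [min_le_left ε (q - P.c (i - 1))]
  have hcont : ContinuousWithinAt (P.fe i) (P.omega x ∩ Ioo (P.c (i - 1)) (P.c i)) q :=
    ((P.lipschitzOnWith_fe h1 hi).continuousOn q hqI).mono
      (inter_subset_right.trans Ioo_subset_Icc_self)
  have hmaps : MapsTo (P.fe i) (P.omega x ∩ Ioo (P.c (i - 1)) (P.c i)) (P.omega x) := by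
    rintro v ⟨hv, hvI⟩
    rw [P.hfe_eq i h1 hi v hvI]
    exact P.map_mem_omega hx hv (P.notMem_Δ_of_mem_Ioo h1 hi hvI)
  have := hcont.mem_closure hnear hmaps
  rwa [(P.isClosed_omega x).closure_eq] at this

end Gaps

end PCIM

namespace PCIM

section Minimality

variable {P : PCIM}

/-- Near `ω(y)` the map contracts the distance to `ω(y)`. -/
theorem exists_infDist_map_le (hinj : P.InjPieces) (hD : P.D ⊆ P.Xt) {y : ℝ} (hy : y ∈ P.Xt) :
    ∃ δ > 0, ∀ p ∈ P.X \ P.Δ, Metric.infDist p (P.omega y) < δ →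
      Metric.infDist (P.f p) (P.omega y) ≤ P.lam * Metric.infDist p (P.omega y) := by
  set K := P.omega y with hK
  have hne : K.Nonempty := P.omega_nonempty hy
  have hcl : IsClosed K := P.isClosed_omega y
  obtain ⟨δ, hδ, hδK⟩ : ∃ δ > 0, ∀ c ∈ P.Δ, Metric.infDist c K < δ → c ∈ K := by
    have h : ∀ c ∈ P.Δ, ∀ᶠ δ in 𝓝[>] (0 : ℝ), Metric.infDist c K < δ → c ∈ K := by
      intro c _
      by_cases hc : c ∈ K
      · exact Eventually.of_forall fun _ _ => hc
      · have hpos := (hcl.notMem_iff_infDist_pos hne).1 hc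
        filter_upwards [Ioo_mem_nhdsGT hpos] with δ hδ hlt
        exact absurd hlt (not_lt.2 hδ.2.le)
    obtain ⟨δ, h, hδ⟩ := (((eventually_all_finite P.finite_Δ).2 h).and
      self_mem_nhdsWithin).exists
    exact ⟨δ, hδ, h⟩
  refine ⟨δ, hδ, fun p hp hpδ => ?_⟩
  obtain ⟨q, hq, hpq⟩ := (P.isCompact_omega hy).exists_infDist_eq_dist hne p
  obtain ⟨i, h1, hi, hpI⟩ := P.exists_mem_Icc hp.1
  have hqX := P.omega_subset_X hy hq
  have hmin : ∀ c ∈ P.Δ, |c - q| < |p - q| → |p - q| ≤ |p - c| := fun c hc hcq => by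
    have hcK : c ∈ K := hδK c hc <| by
      refine (Metric.infDist_le_dist_of_mem hq).trans_lt ?_
      rw [Real.dist_eq]
      rw [hpq, Real.dist_eq] at hpδ
      exact hcq.trans hpδ
    have := Metric.infDist_le_dist_of_mem (x := p) hcK
    rwa [hpq, Real.dist_eq, Real.dist_eq] at this
  have hqI : q ∈ Icc (P.c (i - 1)) (P.c i) := by
    constructor
    · by_contra! h
      have hi1 : 1 < i := by
        rcases h1.eq_or_lt with e | e
        · subst e; exact absurd hqX.1 (not_le.2 h)
        · exact e
      have hc := P.c_mem_Δ (i := i - 1) (by omega) (by omega)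
      have hpc : P.c (i - 1) < p := hpI.1.lt_of_ne fun e => hp.2 (e ▸ hc)
      have := hmin _ hc
      rw [abs_of_pos (by linarith), abs_of_pos (by linarith), abs_of_pos (by linarith)] at this
      linarith [this (by linarith)]
    · by_contra! h
      have hiN : i < P.N := by
        rcases hi.eq_or_lt with e | e
        · subst e; exact absurd hqX.2 (not_le.2 h)
        · exact e
      have hc := P.c_mem_Δ h1 hiN
      have hpc : p < P.c i := hpI.2.lt_of_ne fun e => hp.2 (e ▸ hc)
      have := hmin _ hc
      rw [abs_of_neg (by linarith), abs_of_neg (by linarith), abs_of_neg (by linarith)] at this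
      linarith [this (by linarith)]
  refine (Metric.infDist_le_dist_of_mem (fe_mem_omega hinj hD hy h1 hi hq hqI)).trans ?_
  rw [← P.fe_eq_f h1 hi hpI hp.2, hpq, Real.dist_eq, Real.dist_eq]
  exact P.hfe_lip i h1 hi p hpI q hqI

theorem omega_subset_omega_of_mem (hinj : P.InjPieces) (hD : P.D ⊆ P.Xt) {x y : ℝ}
    (hx : x ∈ P.Xt) (hyx : y ∈ P.omega x) (hy : y ∈ P.Xt) : P.omega x ⊆ P.omega y := by
  obtain ⟨δ, hδ, hcontr⟩ := exists_infDist_map_le hinj hD hy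
  obtain ⟨q, hq⟩ := P.omega_nonempty hy
  have hqx : q ∈ P.omega x := (closure_minimal (P.orbit_subset_omega hx hyx hy)
    (P.isClosed_omega x)) (P.omega_subset_closure_orbit y hq)
  obtain ⟨m, -, hm⟩ := P.mem_omega_iff.1 hqx δ hδ 0
  have hl := P.hlam
  have hmδ : Metric.infDist (P.f^[m] x) (P.omega y) < δ :=
    (Metric.infDist_le_dist_of_mem hq).trans_lt (by rwa [Real.dist_eq])
  have hk : ∀ k, Metric.infDist (P.f^[m + k] x) (P.omega y) ≤ P.lam ^ k * δ := by
    intro k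
    induction k with
    | zero => simpa using hmδ.le
    | succ k ih =>
      have hlt : Metric.infDist (P.f^[m + k] x) (P.omega y) < δ := by
        rcases k with _ | k
        · simpa using hmδ
        · refine ih.trans_lt ?_
          exact mul_lt_of_lt_one_left hδ (pow_lt_one₀ hl.1.le hl.2 (Nat.succ_ne_zero k))
      rw [← add_assoc, Function.iterate_succ_apply', pow_succ']
      have := hcontr _ (hx (m + k)) hlt
      nlinarith [hl.1]
  rintro z ⟨φ, hφ, hlim⟩
  rw [(P.isClosed_omega y).mem_iff_infDist_zero ⟨q, hq⟩]
  have h1 : Tendsto (fun n => Metric.infDist (P.f^[n] x) (P.omega y)) atTop (𝓝 0) := by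
    rw [← tendsto_add_atTop_iff_nat m]
    refine squeeze_zero (fun _ => Metric.infDist_nonneg) (fun k => ?_)
      (by simpa using (tendsto_pow_atTop_nhds_zero_of_lt_one hl.1.le hl.2).mul_const δ)
    rw [add_comm]
    exact hk k
  exact tendsto_nhds_unique
    (((Metric.continuous_infDist_pt (P.omega y)).tendsto z).comp hlim)
    (h1.comp hφ.tendsto_atTop)

theorem closure_orbit_eq_omega (hinj : P.InjPieces) (hD : P.D ⊆ P.Xt) {x y : ℝ}
    (hx : x ∈ P.Xt) (hyx : y ∈ P.omega x) (hy : y ∈ P.Xt) :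
    closure (P.orbit y) = P.omega x :=
  Subset.antisymm (closure_minimal (P.orbit_subset_omega hx hyx hy) (P.isClosed_omega x))
    ((omega_subset_omega_of_mem hinj hD hx hyx hy).trans (P.omega_subset_closure_orbit y))

theorem perfect_omega (hinj : P.InjPieces) (hD : P.D ⊆ P.Xt) {x : ℝ} (hx : x ∈ P.Xt) {i : ℕ}
    (h1 : 1 ≤ i) (hi : i < P.N) (hc : P.c i ∈ P.omega x) : Perfect (P.omega x) := by
  refine ⟨P.isClosed_omega x, fun z hz => ?_⟩
  by_contra hacc
  rw [accPt_iff_nhds] at hacc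
  push Not at hacc
  obtain ⟨U, hU, hUz⟩ := hacc
  have hvisit : ∀ y ∈ P.omega x, y ∈ P.Xt → ∃ n, P.f^[n] y = z := by
    intro y hy hyt
    have hzy : z ∈ closure (P.orbit y) := by
      rwa [closure_orbit_eq_omega hinj hD hx hy hyt]
    obtain ⟨_, hwU, n, rfl⟩ := mem_closure_iff_nhds.1 hzy U hU
    exact ⟨n, hUz _ ⟨hwU, P.iterate_mem_omega hx hy hyt n⟩⟩
  have hd : P.dminus i ∈ P.omega x :=
    fe_mem_omega hinj hD hx h1 hi.le hc ⟨P.c_le (by omega) hi.le, le_rfl⟩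
  have hdt : P.dminus i ∈ P.Xt := hD (Or.inl (Or.inl ⟨i, h1, hi, rfl⟩))
  obtain ⟨n, rfl⟩ := hvisit _ hd hdt
  have hzt := P.iterate_mem_Xt hdt n
  set z := P.f^[n] (P.dminus i)
  obtain ⟨m, hm⟩ := hvisit (P.f z) (P.iterate_mem_omega hx hz hzt 1) (P.iterate_mem_Xt hzt 1)
  have hper : Function.IsPeriodicPt P.f (m + 1) z := hm
  have hfin : (P.orbit z).Finite := by
    refine ((finite_lt_nat (m + 1)).image fun k => P.f^[k] z).subset ?_
    rintro _ ⟨k, rfl⟩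
    exact ⟨k % (m + 1), Nat.mod_lt _ (Nat.succ_pos m), hper.iterate_mod_apply k⟩
  rw [← closure_orbit_eq_omega hinj hD hx hz hzt, hfin.isClosed.closure_eq] at hc
  obtain ⟨k, hk⟩ := hc
  exact (hzt k).2 (by rw [show P.f^[k] z = P.c i from hk]; exact P.c_mem_Δ h1 hi)

end Minimality

section Measure

open MeasureTheory

variable {P : PCIM}

theorem volume_omega {x : ℝ} (hx : x ∈ P.Xt) : volume (P.omega x) = 0 := by
  set K := P.omega x with hK
  have hl := P.hlam
  let I : ℕ → Set ℝ := fun i => Ioo (P.c (i - 1)) (P.c i)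
  have hcover : K ⊆ P.D ∪ ⋃ i ∈ Finset.Icc 1 P.N, P.fe i '' (K ∩ I i) := by
    intro z hz
    by_cases hzD : z ∈ P.D
    · exact Or.inl hzD
    · obtain ⟨i, h1, hi, w, hw, hwI, rfl⟩ := P.exists_preimage hx hz hzD
      exact Or.inr (mem_biUnion (Finset.mem_Icc.2 ⟨h1, hi⟩)
        ⟨w, ⟨hw, hwI⟩, P.hfe_eq i h1 hi w hwI⟩)
  have himage : ∀ i ∈ Finset.Icc 1 P.N,
      volume (P.fe i '' (K ∩ I i)) ≤ ENNReal.ofReal P.lam * volume (K ∩ I i) := by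
    intro i hi
    obtain ⟨h1, hi⟩ := Finset.mem_Icc.1 hi
    have := ((P.lipschitzOnWith_fe h1 hi).mono
      (inter_subset_right.trans Ioo_subset_Icc_self : K ∩ I i ⊆ _)).hausdorffMeasure_image_le
      zero_le_one
    rwa [hausdorffMeasure_real, ENNReal.rpow_one] at this
  have hdisj : (↑(Finset.Icc 1 P.N) : Set ℕ).PairwiseDisjoint fun i => K ∩ I i := by
    have hlt : ∀ i j, 1 ≤ i → j ≤ P.N → i < j → Disjoint (K ∩ I i) (K ∩ I j) := by
      intro i j _ hj hij
      rw [Set.disjoint_left]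
      rintro v ⟨-, hv⟩ ⟨-, hv'⟩
      have := P.c_le (show i ≤ j - 1 by omega) (by omega)
      linarith [hv.2, hv'.1]
    intro i hi j hj hij
    rw [Finset.mem_coe, Finset.mem_Icc] at hi hj
    rcases lt_or_gt_of_ne hij with h | h
    · exact hlt i j hi.1 hj.2 h
    · exact (hlt j i hj.1 hi.2 h).symm
  have hle : volume K ≤ ENNReal.ofReal P.lam * volume K := calc
    volume K ≤ volume P.D + volume (⋃ i ∈ Finset.Icc 1 P.N, P.fe i '' (K ∩ I i)) :=
      (measure_mono hcover).trans (measure_union_le _ _)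
    _ ≤ 0 + ∑ i ∈ Finset.Icc 1 P.N, volume (P.fe i '' (K ∩ I i)) :=
      add_le_add (P.finite_D.measure_zero _).le (measure_biUnion_finset_le _ _)
    _ ≤ ∑ i ∈ Finset.Icc 1 P.N, ENNReal.ofReal P.lam * volume (K ∩ I i) := by
      rw [zero_add]; exact Finset.sum_le_sum himage
    _ = ENNReal.ofReal P.lam * volume (⋃ i ∈ Finset.Icc 1 P.N, K ∩ I i) := by
      rw [← Finset.mul_sum, measure_biUnion_finset hdisj fun i _ =>
        (P.isClosed_omega x).measurableSet.inter measurableSet_Ioo]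
    _ ≤ ENNReal.ofReal P.lam * volume K := by
      gcongr
      exact iUnion₂_subset fun i _ => inter_subset_left
  have hfin : volume K ≠ ⊤ := (P.isCompact_omega hx).measure_ne_top
  by_contra h0
  have h1 : ENNReal.ofReal P.lam * volume K < 1 * volume K :=
    ENNReal.mul_lt_mul_left h0 hfin (by simpa using hl.2)
  rw [one_mul] at h1
  exact absurd hle (not_le.2 h1)

theorem isTotallyDisconnected_omega {x : ℝ} (hx : x ∈ P.Xt) :
    IsTotallyDisconnected (P.omega x) := by
  have key : ∀ t ⊆ P.omega x, IsPreconnected t → ∀ a ∈ t, ∀ b ∈ t, ¬ a < b := by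
    intro t ht hpre a ha b hb hab
    have h := measure_mono_null ((hpre.Icc_subset ha hb).trans ht) (volume_omega hx)
    rw [Real.volume_Icc, ENNReal.ofReal_eq_zero] at h
    linarith
  intro t ht hpre a ha b hb
  exact le_antisymm (not_lt.1 (key t ht hpre b hb a ha)) (not_lt.1 (key t ht hpre a ha b hb))

end Measure

section Finiteness

variable {P : PCIM}

theorem exists_strictMono_tendsto {x : ℝ} {A : Set ℝ} {z : ℝ}
    (h : ∀ ε > 0, ∀ m : ℕ, ∃ n ≥ m, P.f^[n] x ∈ A ∧ |P.f^[n] x - z| < ε) :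
    ∃ φ : ℕ → ℕ, StrictMono φ ∧ (∀ j, P.f^[φ j] x ∈ A) ∧
      Tendsto (fun j => P.f^[φ j] x) atTop (𝓝 z) := by
  obtain ⟨φ, hφ, hlim⟩ := extraction_forall_of_frequently
    (P := fun k n => P.f^[n] x ∈ A ∧ |P.f^[n] x - z| < 1 / ((k : ℝ) + 1)) (fun k => by
      rw [frequently_atTop]
      intro m
      exact h _ (by positivity) m)
  refine ⟨φ, hφ, fun j => (hlim j).1, ?_⟩
  rw [tendsto_iff_dist_tendsto_zero]
  exact squeeze_zero (fun _ => dist_nonneg) (fun n => (hlim n).2.le)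
    tendsto_one_div_add_atTop_nhds_zero_nat

/-- If an orbit does not visit `c i` recurrently from both sides, late orbit points on different
sides of `c i` are uniformly separated. -/
theorem exists_separation {x : ℝ} {i : ℕ} (h1 : 1 ≤ i) (hi : i < P.N)
    (h : ¬ P.lrVisited x i) :
    ∃ ε > 0, ∃ k : ℕ, ∀ n ≥ k, ∀ m ≥ k, P.f^[n] x < P.c i → P.c i < P.f^[m] x →
      ε ≤ P.f^[m] x - P.f^[n] x := by
  by_contra! H
  refine h ⟨h1, hi, ?_⟩
  obtain ⟨l, hl, hl1, hl2⟩ := exists_strictMono_tendsto (P := P) (x := x) (A := P.piece i)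
    (z := P.c i) (fun ε hε k => by
      obtain ⟨n, hn, m, hm, hnc, hcm, hd⟩ := H (min ε (P.c i - P.c (i - 1)))
        (lt_min hε (sub_pos.2 (P.c_lt (by omega) hi.le))) k
      have ha := min_le_left ε (P.c i - P.c (i - 1))
      have hb := min_le_right ε (P.c i - P.c (i - 1))
      exact ⟨n, hn, P.Ioo_subset_piece i ⟨by linarith, hnc⟩,
        abs_lt.2 ⟨by linarith, by linarith⟩⟩)
  obtain ⟨r, hr, hr1, hr2⟩ := exists_strictMono_tendsto (P := P) (x := x) (A := P.piece (i + 1))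
    (z := P.c i) (fun ε hε k => by
      obtain ⟨n, hn, m, hm, hnc, hcm, hd⟩ := H (min ε (P.c (i + 1) - P.c i))
        (lt_min hε (sub_pos.2 (P.c_lt (by omega) hi))) k
      have ha := min_le_left ε (P.c (i + 1) - P.c i)
      have hb := min_le_right ε (P.c (i + 1) - P.c i)
      exact ⟨m, hm, P.Ioo_subset_piece (i + 1) ⟨by simpa using hcm, by linarith⟩,
        abs_lt.2 ⟨by linarith, by linarith⟩⟩)
  exact ⟨l, r, hl, hr, hl1, hr1, hl2, hr2⟩

theorem exists_local_contraction {x : ℝ} (hx : x ∈ P.Xt) (h : ∀ i, ¬ P.lrVisited x i) :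
    ∃ ε > 0, ∃ k : ℕ, ∀ n ≥ k, ∀ m ≥ k, |P.f^[n] x - P.f^[m] x| < ε →
      |P.f^[n + 1] x - P.f^[m + 1] x| ≤ P.lam * |P.f^[n] x - P.f^[m] x| := by
  have hev : ∀ i ∈ Ico 1 P.N, ∀ᶠ k : ℕ in atTop, ∀ n ≥ k, ∀ m ≥ k,
      P.f^[n] x < P.c i → P.c i < P.f^[m] x → 1 / ((k : ℝ) + 1) ≤ P.f^[m] x - P.f^[n] x := by
    intro i hi
    obtain ⟨ε, hε, k₀, hk₀⟩ := exists_separation hi.1 hi.2 (h i)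
    filter_upwards [eventually_ge_atTop k₀,
      (tendsto_one_div_add_atTop_nhds_zero_nat (𝕜 := ℝ)).eventually (gt_mem_nhds hε)]
      with k hk hkε n hn m hm hnc hcm
    exact hkε.le.trans (hk₀ n (hk.trans hn) m (hk.trans hm) hnc hcm)
  obtain ⟨k, hk⟩ := ((eventually_all_finite (finite_Ico 1 P.N)).2 hev).exists
  have key : ∀ n ≥ k, ∀ m ≥ k, P.f^[n] x ≤ P.f^[m] x →
      |P.f^[n] x - P.f^[m] x| < 1 / ((k : ℝ) + 1) →
      |P.f^[n + 1] x - P.f^[m + 1] x| ≤ P.lam * |P.f^[n] x - P.f^[m] x| := by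
    intro n hn m hm hnm hd
    obtain ⟨i, h1, hi, hI⟩ := P.exists_mem_Icc (hx n).1
    have hmI : P.f^[m] x ∈ Icc (P.c (i - 1)) (P.c i) := by
      refine ⟨hI.1.trans hnm, ?_⟩
      by_contra! hlt
      have hiN : i < P.N := by
        rcases hi.eq_or_lt with e | e
        · subst e; exact absurd (hx m).1.2 (not_le.2 hlt)
        · exact e
      have hne : P.f^[n] x < P.c i := hI.2.lt_of_ne fun e => (hx n).2 (e ▸ P.c_mem_Δ h1 hiN)
      have := hk i ⟨h1, hiN⟩ n hn m hm hne hlt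
      linarith [(abs_lt.1 hd).1]
    rw [Function.iterate_succ_apply', Function.iterate_succ_apply',
      ← P.fe_eq_f h1 hi hI (hx n).2, ← P.fe_eq_f h1 hi hmI (hx m).2]
    exact P.hfe_lip i h1 hi _ hI _ hmI
  refine ⟨1 / ((k : ℝ) + 1), by positivity, k, fun n hn m hm hd => ?_⟩
  rcases le_total (P.f^[n] x) (P.f^[m] x) with hle | hle
  · exact key n hn m hm hle hd
  · rw [abs_sub_comm, abs_sub_comm (P.f^[n] x)] at *
    exact key m hm n hn hle hd

theorem finite_omega {x : ℝ} (hx : x ∈ P.Xt) (h : ∀ i, ¬ P.lrVisited x i) :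
    (P.omega x).Finite := by
  obtain ⟨ε, hε, k, hk⟩ := exists_local_contraction hx h
  have hl := P.hlam
  obtain ⟨a, ha⟩ := P.omega_nonempty hx
  obtain ⟨n, hn, hna⟩ := P.mem_omega_iff.1 ha (ε / 2) (half_pos hε) k
  obtain ⟨m, hm, hma⟩ := P.mem_omega_iff.1 ha (ε / 2) (half_pos hε) (n + 1)
  obtain ⟨p, rfl⟩ : ∃ p, m = n + (p + 1) := ⟨m - n - 1, by omega⟩
  have hp : ∀ j, |P.f^[n + j] x - P.f^[n + j + (p + 1)] x| ≤ ε * P.lam ^ j ∧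
      |P.f^[n + j] x - P.f^[n + j + (p + 1)] x| < ε := by
    intro j
    induction j with
    | zero =>
      have : |P.f^[n] x - P.f^[n + (p + 1)] x| < ε := by
        rw [abs_lt] at *
        constructor <;> linarith [hna.1, hna.2, hma.1, hma.2]
      simpa using ⟨this.le, this⟩
    | succ j ih =>
      have h2 := hk (n + j) (by omega) (n + j + (p + 1)) (by omega) ih.2
      have e : n + j + (p + 1) + 1 = n + (j + 1) + (p + 1) := by ring
      rw [e, add_assoc n j 1] at h2
      have h3 := abs_nonneg (P.f^[n + j] x - P.f^[n + j + (p + 1)] x)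
      refine ⟨?_, ?_⟩
      · rw [pow_succ]
        nlinarith [hl.1, ih.1]
      · nlinarith [hl.2, ih.2]
  have hconv : ∀ r, ∃ L, Tendsto (fun q => P.f^[n + (r + q * (p + 1))] x) atTop (𝓝 L) := by
    intro r
    refine cauchySeq_tendsto_of_complete (cauchySeq_of_le_geometric P.lam ε hl.2 fun q => ?_)
    have e : n + (r + (q + 1) * (p + 1)) = n + (r + q * (p + 1)) + (p + 1) := by ring
    rw [Real.dist_eq, e]
    refine (hp _).1.trans (mul_le_mul_of_nonneg_left ?_ hε.le)
    exact pow_le_pow_of_le_one hl.1.le hl.2.le (by nlinarith)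
  choose L hL using hconv
  have hfin : (L '' Iio (p + 1)).Finite := (finite_Iio _).image L
  refine hfin.subset fun z hz => ?_
  rw [← hfin.isClosed.closure_eq, Metric.mem_closure_iff]
  intro η hη
  have hev : ∀ r ∈ Iio (p + 1), ∀ᶠ q in atTop,
      |P.f^[n + (r + q * (p + 1))] x - L r| < η / 2 := fun r _ =>
    (Metric.tendsto_nhds.1 (hL r)) (η / 2) (half_pos hη)
  obtain ⟨Q, hQ⟩ := eventually_atTop.1 ((eventually_all_finite (finite_Iio (p + 1))).2 hev)
  obtain ⟨t, ht, htz⟩ := P.mem_omega_iff.1 hz (η / 2) (half_pos hη) (n + Q * (p + 1))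
  obtain ⟨s, rfl⟩ : ∃ s, t = n + s := ⟨t - n, by omega⟩
  have hmod : s % (p + 1) < p + 1 := Nat.mod_lt _ (Nat.succ_pos p)
  have hdiv : Q ≤ s / (p + 1) := (Nat.le_div_iff_mul_le p.succ_pos).2 (show Q * (p + 1) ≤ s by omega)
  have hclose := hQ _ hdiv _ hmod
  rw [mul_comm, Nat.mod_add_div] at hclose
  refine ⟨_, ⟨_, hmod, rfl⟩, ?_⟩
  rw [Real.dist_eq, abs_lt]
  rw [abs_lt] at hclose htz
  constructor <;> linarith [hclose.1, hclose.2, htz.1, htz.2]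

end Finiteness

end PCIM

/-- If `f` is injective on each piece and `D ⊆ X̃`, then for `x ∈ X̃`:
`Δ_lr(x) ≠ ∅` iff `ω(x)` is a Cantor set (compact, perfect, totally disconnected) `K`
such that `closure (O(y)) = K` for every `y ∈ K ∩ X̃`. -/
theorem stmt19 (P : PCIM) (hinj : P.InjPieces) (hD : P.D ⊆ P.Xt)
    (x : ℝ) (hx : x ∈ P.Xt) :
    (∃ i, P.lrVisited x i) ↔
      (IsCompact (P.omega x) ∧ Perfect (P.omega x) ∧
        IsTotallyDisconnected (P.omega x) ∧
        ∀ y ∈ P.omega x ∩ P.Xt, closure (P.orbit y) = P.omega x) := by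
  constructor
  · rintro ⟨i, h1, hi, l, -, hl, -, -, -, hlim, -⟩
    exact ⟨P.isCompact_omega hx, PCIM.perfect_omega hinj hD hx h1 hi ⟨l, hl, hlim⟩,
      PCIM.isTotallyDisconnected_omega hx,
      fun y hy => PCIM.closure_orbit_eq_omega hinj hD hx hy.1 hy.2⟩
  · rintro ⟨-, hperf, -, -⟩
    by_contra! h
    obtain ⟨z, hz⟩ := P.omega_nonempty hx
    exact Set.Infinite.of_accPt (hperf.acc z hz) (PCIM.finite_omega hx h)
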